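/- arXiv:2403.01797 — 4 statements merged into one kernel-verified Lean document; each statement's English description precedes it below -/
import Mathlib

section
/- Let d ≥ 1, let P ⊆ {0,1}^d be a finite set of n ≥ 2 points of the Hamming cube, let q ∈ {0,1}^d, and let p* ∈ P be a point minimizing the Hamming distance to q, with δ* := ‖p*−q‖₀ satisfying 0 < δ* ≤ d/2. Let c > 0 and t := ⌈(4·d·ln n)/(c·δ*)⌉, and perform a single bit-sampling trial with t samples. Then the probability that p* fully collides with q in the trial is at least (1/2)·n^(−8/c). -/
open Finset

/-- The number of `t`-tuples of coordinates on which `x` and `y` agree. -/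
theorem card_filter_forall_agree {d : ℕ} (t : ℕ) (x y : Fin d → Bool) :
    (univ.filter fun f : Fin t → Fin d => ∀ j, x (f j) = y (f j)).card
      = (d - hammingDist x y) ^ t := by
  have h : (univ.filter fun f : Fin t → Fin d => ∀ j, x (f j) = y (f j))
      = Fintype.piFinset fun _ => univ.filter fun i => x i = y i := by
    ext f
    simp
  have hsum := card_filter_add_card_filter_not (s := (univ : Finset (Fin d))) (fun i => x i = y i)
  rw [card_univ, Fintype.card_fin] at hsum
  have hagree : (univ.filter fun i => x i = y i).card = d - hammingDist x y := by
    rw [hammingDist]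
    exact Nat.eq_sub_of_add_eq hsum
  rw [h, Fintype.card_piFinset_const, hagree]

theorem neg_two_mul_le_log_one_sub {x : ℝ} (hx0 : 0 ≤ x) (hx : x ≤ 1 / 2) :
    -2 * x ≤ Real.log (1 - x) := by
  have hpos : 0 < 1 - x := by linarith
  refine le_trans ?_ (Real.one_sub_inv_le_log_of_pos hpos)
  have h : 1 - (1 - x)⁻¹ = -x / (1 - x) := by
    field_simp
    ring
  rw [h, le_div_iff₀ hpos]
  nlinarith

theorem half_mul_exp_le_one_sub_pow {x T : ℝ} (hx0 : 0 ≤ x) (hx : x ≤ 1 / 2) (hT : 0 ≤ T) :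
    1 / 2 * Real.exp (-2 * x * T) ≤ (1 - x) ^ ⌈T⌉₊ := by
  have hpos : 0 < 1 - x := by linarith
  calc 1 / 2 * Real.exp (-2 * x * T)
      ≤ (1 - x) * (1 - x) ^ T := by
        rw [Real.rpow_def_of_pos hpos]
        have h := neg_two_mul_le_log_one_sub hx0 hx
        gcongr
        linarith
    _ = (1 - x) ^ (T + 1) := by
        rw [Real.rpow_add hpos, Real.rpow_one, mul_comm]
    _ ≤ (1 - x) ^ (⌈T⌉₊ : ℝ) :=
        Real.rpow_le_rpow_of_exponent_ge hpos (by linarith) (Nat.ceil_lt_add_one hT).le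
    _ = (1 - x) ^ ⌈T⌉₊ := Real.rpow_natCast _ _

/-- Let `d ≥ 1`, let `P` be a finite set of `n ≥ 2` points of the Hamming cube `Fin d → Bool`,
let `q` be a point, and let `pstar ∈ P` minimize the Hamming distance to `q`, with
`δ* = hammingDist pstar q` satisfying `0 < δ* ≤ d/2`. Let `c > 0` and
`t = ⌈(4·d·ln n)/(c·δ*)⌉`. In a single bit-sampling trial with `t` samples (modeled by
counting tuples `f : Fin t → Fin d`), the probability that `pstar` fully collides with `q`
is at least `(1/2)·n^(−8/c)`. -/
theorem near_neighbor_full_collision_lower_bound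
    (d : ℕ) (hd : 1 ≤ d) (P : Finset (Fin d → Bool)) (hn : 2 ≤ P.card)
    (q : Fin d → Bool) (pstar : Fin d → Bool) (hpstar : pstar ∈ P)
    (hmin : ∀ p ∈ P, hammingDist pstar q ≤ hammingDist p q)
    (hδpos : 0 < hammingDist pstar q)
    (hδle : (hammingDist pstar q : ℝ) ≤ (d : ℝ) / 2)
    (c : ℝ) (hc : 0 < c) (t : ℕ)
    (ht : t = ⌈4 * (d : ℝ) * Real.log P.card / (c * (hammingDist pstar q : ℝ))⌉₊) :
    ((univ.filter fun f : Fin t → Fin d => ∀ j, pstar (f j) = q (f j)).card : ℝ) / (d : ℝ) ^ t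
      ≥ (1 / 2) * (P.card : ℝ) ^ (-8 / c) := by
  have hd0 : (0 : ℝ) < d := by exact_mod_cast hd
  have hδ0 : (0 : ℝ) < hammingDist pstar q := by exact_mod_cast hδpos
  have hn0 : (0 : ℝ) < P.card := by exact_mod_cast (by omega : 0 < P.card)
  have hlog : 0 ≤ Real.log P.card := Real.log_natCast_nonneg _
  have hle : hammingDist pstar q ≤ d := by
    simpa using hammingDist_le_card_fintype (x := pstar) (y := q)
  have hx : (hammingDist pstar q : ℝ) / d ≤ 1 / 2 := by
    rw [div_le_iff₀ hd0]
    linarith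
  have hbase : ((d : ℝ) - hammingDist pstar q) / d = 1 - hammingDist pstar q / d := by
    rw [sub_div, div_self hd0.ne']
  rw [card_filter_forall_agree, Nat.cast_pow, Nat.cast_sub hle, ← div_pow, hbase, ht,
    Real.rpow_def_of_pos hn0]
  refine le_trans (le_of_eq ?_) (half_mul_exp_le_one_sub_pow (by positivity) hx (by positivity))
  congr 2
  field_simp
  ring
end

section
/- Let d ≥ 1, let P ⊆ {0,1}^d be a finite set of n ≥ 2 points of the Hamming cube, let q ∈ {0,1}^d, let δ* > 0 be a real number, and let c > 0. Let t := ⌈(4·d·ln n)/(c·δ*)⌉ and perform a single bit-sampling trial with t samples. Then for every point x ∈ P with Hamming distance ‖x−q‖₀ ≥ c·δ*, the probability that x fully collides with q in the trial is at most n^(−4). -/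
open Finset

theorem card_filter_forall_mem_pi {ι α : Type*} [Fintype ι] [DecidableEq ι] [Fintype α]
    (p : α → Prop) [DecidablePred p] [DecidablePred fun f : ι → α => ∀ j, p (f j)] :
    (univ.filter fun f : ι → α => ∀ j, p (f j)).card =
      (univ.filter p).card ^ Fintype.card ι := by
  have h : (univ.filter fun f : ι → α => ∀ j, p (f j)) =
      Fintype.piFinset fun _ => univ.filter p := by
    ext f
    simp [Fintype.mem_piFinset]
  simp [h, Fintype.card_piFinset]

theorem card_filter_eq_add_hammingDist {ι β : Type*} [Fintype ι] [DecidableEq β]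
    (x y : ι → β) :
    (univ.filter fun i => x i = y i).card + hammingDist x y = Fintype.card ι :=
  card_filter_add_card_filter_not (s := univ) fun i => x i = y i

/-- The probability that `x` and `q` agree on `t` independent uniform coordinates decays
exponentially in `t` times their relative Hamming distance. -/
theorem full_collision_probability_le_exp {β : Type*} [DecidableEq β] {d : ℕ} (hd : 1 ≤ d)
    (x q : Fin d → β) (t : ℕ) :
    ((univ.filter fun f : Fin t → Fin d => ∀ j, x (f j) = q (f j)).card : ℝ) / (d : ℝ) ^ t
      ≤ Real.exp (-(t * (hammingDist x q / d))) := by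
  have hd0 : (0 : ℝ) < d := by exact_mod_cast hd
  have hcard : ((univ.filter fun i => x i = q i).card : ℝ) + hammingDist x q = d := by
    exact_mod_cast (card_filter_eq_add_hammingDist x q).trans (Fintype.card_fin d)
  rw [card_filter_forall_mem_pi fun i => x i = q i, Fintype.card_fin, Nat.cast_pow, ← div_pow,
    ← mul_neg, Real.exp_nat_mul]
  gcongr
  have hfrac : ((univ.filter fun i => x i = q i).card : ℝ) / d =
      -(hammingDist x q / d) + 1 := by
    field_simp
    linarith
  rw [hfrac]
  exact Real.add_one_le_exp _

/-- Let `d ≥ 1`, let `P` be a finite set of `n ≥ 2` points of the Hamming cube `Fin d → Bool`,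
let `q` be a point, let `δ* > 0` be a real number, and let `c > 0`. Let
`t = ⌈(4·d·ln n)/(c·δ*)⌉` and perform a single bit-sampling trial with `t` samples
(modeled by counting tuples `f : Fin t → Fin d`). Then for every `x ∈ P` with
`hammingDist x q ≥ c·δ*`, the probability that `x` fully collides with `q` is at most
`n^(−4)`. -/
theorem far_point_full_collision_upper_bound
    (d : ℕ) (hd : 1 ≤ d) (P : Finset (Fin d → Bool)) (hn : 2 ≤ P.card)
    (q : Fin d → Bool) (δstar : ℝ) (hδstar : 0 < δstar) (c : ℝ) (hc : 0 < c)
    (t : ℕ) (ht : t = ⌈4 * (d : ℝ) * Real.log P.card / (c * δstar)⌉₊) :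
    ∀ x ∈ P, c * δstar ≤ (hammingDist x q : ℝ) →
      ((univ.filter fun f : Fin t → Fin d => ∀ j, x (f j) = q (f j)).card : ℝ) / (d : ℝ) ^ t
        ≤ (P.card : ℝ) ^ (-4 : ℝ) := by
  intro x _ hx
  have hd0 : (0 : ℝ) < d := by exact_mod_cast hd
  have hn0 : (0 : ℝ) < P.card := by exact_mod_cast (by omega : 0 < P.card)
  refine (full_collision_probability_le_exp hd x q t).trans ?_
  rw [Real.rpow_def_of_pos hn0, Real.exp_le_exp]
  have hceil : 4 * (d : ℝ) * Real.log P.card / (c * δstar) ≤ t := ht ▸ Nat.le_ceil _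
  have hbound : 4 * (d : ℝ) * Real.log P.card ≤ t * hammingDist x q :=
    ((div_le_iff₀ (by positivity)).1 hceil).trans (by gcongr)
  have hdiv : 4 * Real.log P.card ≤ t * (hammingDist x q / d) := by
    rw [← mul_div_assoc, le_div_iff₀ hd0]
    linarith
  linarith
end

section
/- Let d ≥ 1, let P ⊆ {0,1}^d be a finite set of n ≥ 2 points of the Hamming cube, let q ∈ {0,1}^d, and let p* ∈ P be a point minimizing the Hamming distance to q, with δ* := ‖p*−q‖₀ satisfying 0 < δ* ≤ d/2. Let c > 0, let t := ⌈(4·d·ln n)/(c·δ*)⌉, and perform r independent bit-sampling trials, each with t samples. Then with probability at least 1 − (1 − (1/2)·n^(−8/c))^r − r·n·n^(−4), there exists a trial j ∈ {1,…,r} such that p* fully collides with q in trial j and no point x ∈ P with ‖x−q‖₀ ≥ c·δ* fully collides with q in trial j. -/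
open Finset
open scoped Classical

lemma pow_le_pow_add_mul {u v w : ℝ} (hu0 : 0 ≤ u) (hu1 : u ≤ 1) (hv0 : 0 ≤ v) (hv1 : v ≤ 1)
    (hw : 0 ≤ w) (h : u ≤ v + w) (r : ℕ) : u ^ r ≤ v ^ r + r * w := by
  induction r with
  | zero => simp
  | succ r ih =>
    have hvr : v ^ r ≤ 1 := pow_le_one₀ hv0 hv1
    have hvr0 : 0 ≤ v ^ r := pow_nonneg hv0 r
    have hrw : 0 ≤ (r : ℝ) * w := by positivity
    push_cast
    calc u ^ (r + 1) = u * u ^ r := pow_succ' u r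
      _ ≤ u * (v ^ r + r * w) := by gcongr
      _ ≤ (v + w) * v ^ r + r * w := by nlinarith
      _ ≤ v ^ (r + 1) + (r + 1) * w := by rw [pow_succ']; nlinarith

lemma card_filter_exists_mem_div {α : Type*} [Fintype α] [DecidableEq α] [Nonempty α]
    (S : Finset α) (r : ℕ) :
    ((univ.filter fun F : Fin r → α => ∃ j, F j ∈ S).card : ℝ) / (Fintype.card α : ℝ) ^ r =
      1 - (1 - (S.card : ℝ) / Fintype.card α) ^ r := by
  have hN : (Fintype.card α : ℝ) ≠ 0 := by simp
  have hcompl : (univ.filter fun F : Fin r → α => ∃ j, F j ∈ S) =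
      (Fintype.piFinset fun _ : Fin r => Sᶜ)ᶜ := by
    ext F
    simp [Fintype.mem_piFinset]
  have hcard : ((Fintype.piFinset fun _ : Fin r => Sᶜ).card : ℝ) =
      ((Fintype.card α : ℝ) - S.card) ^ r := by
    rw [Fintype.card_piFinset, prod_const, card_univ, Fintype.card_fin, card_compl,
      Nat.cast_pow, Nat.cast_sub (card_le_univ S)]
  rw [hcompl, card_compl, Nat.cast_sub (card_le_univ _), hcard, Fintype.card_fun,
    Fintype.card_fin, Nat.cast_pow, sub_div, div_self (pow_ne_zero r hN), ← div_pow, sub_div,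
    div_self hN]

lemma card_filter_forall_eq_div {d : ℕ} (hd : 1 ≤ d) (x q : Fin d → Bool) (t : ℕ) :
    ((univ.filter fun G : Fin t → Fin d => ∀ i, x (G i) = q (G i)).card : ℝ) / (d : ℝ) ^ t =
      (1 - (hammingDist x q : ℝ) / d) ^ t := by
  have hd' : (d : ℝ) ≠ 0 := by exact_mod_cast (by omega : d ≠ 0)
  have hpi : (univ.filter fun G : Fin t → Fin d => ∀ i, x (G i) = q (G i)) =
      Fintype.piFinset fun _ : Fin t => univ.filter fun k => x k = q k := by
    ext G
    simp [Fintype.mem_piFinset]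
  have hsum : ((univ.filter fun k => x k = q k).card : ℝ) + hammingDist x q = d := by
    have := card_filter_add_card_filter_not (s := (univ : Finset (Fin d))) (fun k => x k = q k)
    rw [card_univ, Fintype.card_fin] at this
    exact_mod_cast this
  rw [hpi, Fintype.card_piFinset, prod_const, card_univ, Fintype.card_fin, Nat.cast_pow,
    ← div_pow, eq_sub_of_add_eq hsum, sub_div, div_self hd']

lemma one_sub_pow_le_rpow {n y : ℝ} {t : ℕ} (hn : 0 < n) (hy : y ≤ 1)
    (ht : 4 * Real.log n ≤ y * t) : (1 - y) ^ t ≤ n ^ (-4 : ℝ) := by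
  calc (1 - y) ^ t ≤ Real.exp (-y) ^ t :=
        pow_le_pow_left₀ (by linarith) (Real.one_sub_le_exp_neg y) t
    _ = Real.exp (t * -y) := (Real.exp_nat_mul _ _).symm
    _ ≤ n ^ (-4 : ℝ) := by
        rw [Real.rpow_def_of_pos hn, Real.exp_le_exp]
        linarith

lemma exp_neg_two_mul_le_one_sub {y : ℝ} (hy0 : 0 ≤ y) (hy : y ≤ 1 / 2) :
    Real.exp (-(2 * y)) ≤ 1 - y := by
  rw [Real.exp_neg]
  refine inv_le_of_inv_le₀ (by linarith) (le_trans ?_ (Real.add_one_le_exp (2 * y)))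
  rw [inv_le_iff_one_le_mul₀ (by linarith)]
  nlinarith

lemma half_mul_rpow_le_one_sub_pow {n c y : ℝ} {t : ℕ} (hn : 0 < n) (hlog : 0 ≤ Real.log n)
    (hc : 0 < c) (hy0 : 0 < y) (hy : y ≤ 1 / 2) (ht : (t : ℝ) ≤ 4 * Real.log n / (c * y) + 1) :
    1 / 2 * n ^ (-8 / c) ≤ (1 - y) ^ t := by
  have hy1 : 0 < 1 - y := by linarith
  have he : 0 ≤ 4 * Real.log n / (c * y) := by positivity
  calc 1 / 2 * n ^ (-8 / c)
      = 1 / 2 * Real.exp (-(2 * y)) ^ (4 * Real.log n / (c * y)) := by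
        rw [Real.rpow_def_of_pos hn, ← Real.exp_mul]
        congr 2
        field_simp
        ring
    _ ≤ (1 - y) * (1 - y) ^ (4 * Real.log n / (c * y)) := by
        gcongr
        · linarith
        · exact exp_neg_two_mul_le_one_sub hy0.le hy
    _ = (1 - y) ^ (4 * Real.log n / (c * y) + 1) := by
        rw [Real.rpow_add_one hy1.ne', mul_comm]
    _ ≤ (1 - y) ^ (t : ℝ) := Real.rpow_le_rpow_of_exponent_ge hy1 (by linarith) ht
    _ = (1 - y) ^ t := Real.rpow_natCast _ _

/-- Let `d ≥ 1`, let `P` be a finite set of `n ≥ 2` points of the Hamming cube `Fin d → Bool`,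
let `q` be a point, and let `pstar ∈ P` minimize the Hamming distance to `q`, with
`δ* = hammingDist pstar q` satisfying `0 < δ* ≤ d/2`. Let `c > 0`,
`t = ⌈(4·d·ln n)/(c·δ*)⌉`, and perform `r` independent bit-sampling trials with `t` samples
each (modeled by counting families `F : Fin r → Fin t → Fin d`). Then with probability at
least `1 − (1 − (1/2)·n^(−8/c))^r − r·n·n^(−4)` there is a trial `j` in which `pstar` fully
collides with `q` while no point `x ∈ P` with `hammingDist x q ≥ c·δ*` fully collides
with `q`. -/
theorem sorting_lsh_good_trial_probability
    (d : ℕ) (hd : 1 ≤ d) (P : Finset (Fin d → Bool)) (hn : 2 ≤ P.card)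
    (q : Fin d → Bool) (pstar : Fin d → Bool) (hpstar : pstar ∈ P)
    (hmin : ∀ p ∈ P, hammingDist pstar q ≤ hammingDist p q)
    (hδpos : 0 < hammingDist pstar q)
    (hδle : (hammingDist pstar q : ℝ) ≤ (d : ℝ) / 2)
    (c : ℝ) (hc : 0 < c) (t : ℕ)
    (ht : t = ⌈4 * (d : ℝ) * Real.log P.card / (c * (hammingDist pstar q : ℝ))⌉₊)
    (r : ℕ) :
    ((univ.filter fun F : Fin r → Fin t → Fin d =>
        ∃ j, (∀ i, pstar (F j i) = q (F j i)) ∧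
          ∀ x ∈ P, c * (hammingDist pstar q : ℝ) ≤ (hammingDist x q : ℝ) →
            ¬ (∀ i, x (F j i) = q (F j i))).card : ℝ) / ((d : ℝ) ^ t) ^ r
      ≥ 1 - (1 - (1 / 2) * (P.card : ℝ) ^ (-8 / c)) ^ r
          - (r : ℝ) * (P.card : ℝ) * (P.card : ℝ) ^ (-4 : ℝ) := by
  subst ht
  set t := ⌈4 * (d : ℝ) * Real.log P.card / (c * (hammingDist pstar q : ℝ))⌉₊
  have hd' : (0 : ℝ) < d := by exact_mod_cast hd
  have hn1 : (1 : ℝ) ≤ P.card := by exact_mod_cast (by omega : 1 ≤ P.card)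
  have hn0 : (0 : ℝ) < P.card := by linarith
  have hδ : (0 : ℝ) < hammingDist pstar q := by exact_mod_cast hδpos
  have hlog : 0 ≤ Real.log P.card := Real.log_nonneg hn1
  have : Nonempty (Fin d) := ⟨⟨0, hd⟩⟩
  let A : Finset (Fin t → Fin d) := univ.filter fun G => ∀ i, pstar (G i) = q (G i)
  let far : Finset (Fin d → Bool) :=
    P.filter fun x => c * (hammingDist pstar q : ℝ) ≤ (hammingDist x q : ℝ)
  let B : Finset (Fin t → Fin d) :=
    far.biUnion fun x => univ.filter fun G => ∀ i, x (G i) = q (G i)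
  have hN : (Fintype.card (Fin t → Fin d) : ℝ) = (d : ℝ) ^ t := by simp
  have hA : 1 / 2 * (P.card : ℝ) ^ (-8 / c) ≤ (A.card : ℝ) / (d : ℝ) ^ t := by
    rw [card_filter_forall_eq_div hd]
    refine half_mul_rpow_le_one_sub_pow hn0 hlog hc (by positivity) ?_ ?_
    · rw [div_le_iff₀ hd']; linarith
    · have hexp : 4 * Real.log P.card / (c * ((hammingDist pstar q : ℝ) / d)) =
          4 * (d : ℝ) * Real.log P.card / (c * (hammingDist pstar q : ℝ)) := by
        field_simp
      rw [hexp]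
      exact (Nat.ceil_lt_add_one (by positivity)).le
  have hB : (B.card : ℝ) / (d : ℝ) ^ t ≤ (P.card : ℝ) * (P.card : ℝ) ^ (-4 : ℝ) := by
    calc (B.card : ℝ) / (d : ℝ) ^ t
        ≤ (∑ x ∈ far, ((univ.filter fun G : Fin t → Fin d =>
            ∀ i, x (G i) = q (G i)).card : ℝ)) / (d : ℝ) ^ t := by
          gcongr
          exact_mod_cast card_biUnion_le
      _ = ∑ x ∈ far, ((univ.filter fun G : Fin t → Fin d =>
            ∀ i, x (G i) = q (G i)).card : ℝ) / (d : ℝ) ^ t := by rw [sum_div]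
      _ ≤ ∑ x ∈ far, (P.card : ℝ) ^ (-4 : ℝ) := by
          refine sum_le_sum fun x hx => ?_
          rw [card_filter_forall_eq_div hd]
          have hx' := (mem_filter.1 hx).2
          have hxd : (hammingDist x q : ℝ) ≤ d := by
            exact_mod_cast (hammingDist_le_card_fintype (x := x) (y := q)).trans_eq
              (Fintype.card_fin d)
          refine one_sub_pow_le_rpow hn0 ((div_le_one hd').2 hxd) ?_
          calc 4 * Real.log P.card
              = c * (hammingDist pstar q : ℝ) / d *
                  (4 * (d : ℝ) * Real.log P.card / (c * (hammingDist pstar q : ℝ))) := by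
                field_simp
            _ ≤ (hammingDist x q : ℝ) / d * t := by
                gcongr
                exact Nat.le_ceil _
      _ = far.card * (P.card : ℝ) ^ (-4 : ℝ) := by rw [sum_const, nsmul_eq_mul]
      _ ≤ (P.card : ℝ) * (P.card : ℝ) ^ (-4 : ℝ) := by
          gcongr
          exact filter_subset _ _
  have hpow : (P.card : ℝ) ^ (-8 / c) ≤ 1 :=
    Real.rpow_le_one_of_one_le_of_nonpos hn1 (div_nonpos_of_nonpos_of_nonneg (by norm_num) hc.le)
  have hpow0 : 0 ≤ (P.card : ℝ) ^ (-8 / c) := by positivity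
  have hgood : (univ.filter fun F : Fin r → Fin t → Fin d =>
        ∃ j, (∀ i, pstar (F j i) = q (F j i)) ∧
          ∀ x ∈ P, c * (hammingDist pstar q : ℝ) ≤ (hammingDist x q : ℝ) →
            ¬ (∀ i, x (F j i) = q (F j i))) =
      univ.filter fun F : Fin r → Fin t → Fin d => ∃ j, F j ∈ A \ B := by
    ext F
    simp [A, B, far]
  have hAB : (A.card : ℝ) - B.card ≤ (A \ B).card := by
    have := le_card_sdiff B A
    rw [tsub_le_iff_right] at this
    rw [sub_le_iff_le_add]
    exact_mod_cast this
  rw [hgood, ← hN, card_filter_exists_mem_div, hN]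
  have hsdiff : (A.card : ℝ) / (d : ℝ) ^ t - B.card / (d : ℝ) ^ t ≤
      (A \ B).card / (d : ℝ) ^ t := by
    rw [← sub_div]; gcongr
  have hle : ((A \ B).card : ℝ) / (d : ℝ) ^ t ≤ 1 := by
    rw [div_le_one (by positivity), ← hN]
    exact_mod_cast card_le_univ _
  have := pow_le_pow_add_mul (u := 1 - ((A \ B).card : ℝ) / (d : ℝ) ^ t)
    (v := 1 - 1 / 2 * (P.card : ℝ) ^ (-8 / c))
    (w := (P.card : ℝ) * (P.card : ℝ) ^ (-4 : ℝ)) (by linarith)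
    (sub_le_self _ (by positivity)) (by linarith) (by linarith) (by positivity) (by linarith) r
  rw [mul_assoc]
  linarith
end

section
/- Let Σ be a linearly ordered alphabet, let S be a finite set of strings over Σ, let q be a string over Σ, and suppose the set {s ∈ S : s ≤ q} (in lexicographic order) is nonempty with maximum element b. Then for every x ∈ S with x ≤ q, the longest common prefix of x and q is a prefix of b; in particular, the length of the longest common prefix of b and q is at least the length of the longest common prefix of x and q. -/
/-- The longest common prefix of two strings (lists). -/
def longestCommonPrefix {α : Type*} [DecidableEq α] : List α → List α → List α
  | a :: as, b :: bs => if a = b then a :: longestCommonPrefix as bs else []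
  | _, _ => []

theorem cons_le_cons_iff_lt_or_eq {α : Type*} [LinearOrder α] {a b : α} {as bs : List α} :
    a :: as ≤ b :: bs ↔ a < b ∨ a = b ∧ as ≤ bs := by
  simp only [← not_lt, List.cons_lt_cons_iff]
  grind

theorem longestCommonPrefix_prefix_of_le_of_le {α : Type*} [LinearOrder α] :
    ∀ {x b q : List α}, x ≤ b → b ≤ q →
      longestCommonPrefix x q <+: longestCommonPrefix b q
  | [], _, _, _, _ => by simp [longestCommonPrefix]
  | _ :: _, _, [], _, _ => by simp [longestCommonPrefix]
  | a :: x, [], _ :: _, hxb, _ => absurd (List.nil_lt_cons a x) (not_lt_of_ge hxb)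
  | a :: x, c :: b, d :: q, hxb, hbq => by
    replace hxb := cons_le_cons_iff_lt_or_eq.1 hxb
    replace hbq := cons_le_cons_iff_lt_or_eq.1 hbq
    by_cases had : a = d
    · subst had
      obtain ⟨rfl, hxb'⟩ : a = c ∧ x ≤ b := by
        rcases hxb with h | h
        · rcases hbq with h' | h'
          · exact absurd h h'.asymm
          · exact absurd h'.1 h.ne'
        · exact h
      have hbq' : b ≤ q := by simpa using hbq
      simpa [longestCommonPrefix] using longestCommonPrefix_prefix_of_le_of_le hxb' hbq'
    · simp [longestCommonPrefix, had]

theorem longestCommonPrefix_prefix_left {α : Type*} [DecidableEq α] :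
    ∀ a b : List α, longestCommonPrefix a b <+: a
  | [], _ => by simp [longestCommonPrefix]
  | _ :: _, [] => by simp [longestCommonPrefix]
  | a :: as, b :: bs => by
    by_cases h : a = b
    · simpa [longestCommonPrefix, h] using longestCommonPrefix_prefix_left as bs
    · simp [longestCommonPrefix, h]

/-- Let `Σ` be a linearly ordered alphabet, `S` a finite set of strings over `Σ`, `q` a
string, and suppose `{s ∈ S : s ≤ q}` (lexicographic order) is nonempty with maximum
element `b`. Then for every `x ∈ S` with `x ≤ q`, the longest common prefix of `x` and `q`
is a prefix of `b`; in particular the longest common prefix of `b` and `q` is at least as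
long as that of `x` and `q`. -/
theorem lex_max_maximizes_common_prefix {Sigma : Type*} [LinearOrder Sigma]
    (S : Finset (List Sigma)) (q b : List Sigma)
    (hbS : b ∈ S) (hbq : b ≤ q) (hbmax : ∀ s ∈ S, s ≤ q → s ≤ b) :
    ∀ x ∈ S, x ≤ q →
      longestCommonPrefix x q <+: b ∧
        (longestCommonPrefix x q).length ≤ (longestCommonPrefix b q).length := by
  intro x hxS hxq
  have h := longestCommonPrefix_prefix_of_le_of_le (hbmax x hxS hxq) hbq
  exact ⟨h.trans (longestCommonPrefix_prefix_left b q), h.length_le⟩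
end
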